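/- The following three statements are equivalent: (A) liminf_{t→∞} Σ²(t) ∈ (0,∞) (along real t); (B) liminf_{n→∞} Σ²(n) ∈ (0,∞) (along integers n); (C) liminf_{n→∞} Θ²(n)·log n ∈ (0,∞). Moreover each of them implies that liminf_{n→∞} θ(n)²·log n ∈ [0,∞), i.e. that liminf_{n→∞} θ(n)²·log n is finite. -/

import Mathlib

/-- `theta σ n ≥ 0` with `(theta σ n)^2 = ∫_n^{n+1} σ(s)^2 ds`. -/
noncomputable def theta (σ : ℝ → ℝ) (n : ℕ) : ℝ :=
  Real.sqrt (∫ s in (n : ℝ)..((n : ℝ) + 1), (σ s) ^ 2)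

/-- `Σ²(t) = (∫_0^t e^{−2(t−s)} σ(s)² ds)·log t`. -/
noncomputable def Sig2 (σ : ℝ → ℝ) (t : ℝ) : ℝ :=
  (∫ s in (0 : ℝ)..t, Real.exp (-2 * (t - s)) * (σ s) ^ 2) * Real.log t

/-- `Θ²(n) = ∑_{j=0}^{n−1} e^{−2(n−j)} θ(j)²`. -/
noncomputable def Theta2 (σ : ℝ → ℝ) (n : ℕ) : ℝ :=
  ∑ j ∈ Finset.range n, Real.exp (-2 * ((n : ℝ) - (j : ℝ))) * (theta σ j) ^ 2

open Filter Set

theorem pos_liminf_coe_iff {α : Type*} {l : Filter α} {f : α → ℝ} :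
    0 < liminf (fun a => (f a : EReal)) l ↔ ∃ ε > 0, ∀ᶠ a in l, ε ≤ f a := by
  constructor
  · intro h
    obtain ⟨ε, hε, hε'⟩ := EReal.lt_iff_exists_real_btwn.1 h
    refine ⟨ε, by exact_mod_cast hε, ?_⟩
    filter_upwards [eventually_lt_of_lt_liminf hε'] with a ha
    exact_mod_cast ha.le
  · rintro ⟨ε, hε, h⟩
    refine lt_of_lt_of_le (b := (ε : EReal)) (by exact_mod_cast hε)
      (le_liminf_of_le (by isBoundedDefault) ?_)
    filter_upwards [h] with a ha
    exact_mod_cast ha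

theorem liminf_coe_lt_top_iff {α : Type*} {l : Filter α} {f : α → ℝ} :
    liminf (fun a => (f a : EReal)) l < ⊤ ↔ ∃ M : ℝ, ∃ᶠ a in l, f a ≤ M := by
  constructor
  · intro h
    obtain ⟨M, hM, -⟩ := EReal.lt_iff_exists_real_btwn.1 h
    refine ⟨M, (frequently_lt_of_liminf_lt (by isBoundedDefault) hM).mono fun a ha => ?_⟩
    exact_mod_cast ha.le
  · rintro ⟨M, h⟩
    refine lt_of_le_of_lt (liminf_le_of_frequently_le (a := (M : EReal)) (h.mono fun a ha => ?_)
      (by isBoundedDefault)) (EReal.coe_lt_top M)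
    exact_mod_cast ha

theorem pos_liminf_coe_of_le_mul {α β : Type*} {l : Filter α} {l' : Filter β} {f : α → ℝ}
    {g : β → ℝ} {φ : α → β} {c : ℝ} (hc : 0 < c) (hφ : Tendsto φ l l')
    (h : ∀ᶠ a in l, g (φ a) ≤ c * f a) (hg : 0 < liminf (fun b => (g b : EReal)) l') :
    0 < liminf (fun a => (f a : EReal)) l := by
  obtain ⟨ε, hε, hg⟩ := pos_liminf_coe_iff.1 hg
  refine pos_liminf_coe_iff.2 ⟨ε / c, div_pos hε hc, ?_⟩
  filter_upwards [h, hφ.eventually hg] with a ha hga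
  rw [div_le_iff₀' hc]
  exact hga.trans ha

theorem liminf_coe_lt_top_of_le_mul {α β : Type*} {l : Filter α} {l' : Filter β} {f : α → ℝ}
    {g : β → ℝ} {φ : α → β} {c : ℝ} (hc : 0 < c) (hφ : Tendsto φ l l')
    (h : ∀ᶠ a in l, g (φ a) ≤ c * f a) (hf : liminf (fun a => (f a : EReal)) l < ⊤) :
    liminf (fun b => (g b : EReal)) l' < ⊤ := by
  obtain ⟨M, hM⟩ := liminf_coe_lt_top_iff.1 hf
  refine liminf_coe_lt_top_iff.2 ⟨c * M, hφ.frequently ((hM.and_eventually h).mono ?_)⟩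
  rintro a ⟨ha, hga⟩
  exact hga.trans (mul_le_mul_of_nonneg_left ha hc.le)

/-- The weighted integral `∫_0^t e^{−2(t−s)} σ(s)² ds`. -/
noncomputable def expConv (σ : ℝ → ℝ) (t : ℝ) : ℝ :=
  ∫ s in (0 : ℝ)..t, Real.exp (-2 * (t - s)) * (σ s) ^ 2

theorem Sig2_eq (σ : ℝ → ℝ) (t : ℝ) : Sig2 σ t = expConv σ t * Real.log t := rfl

theorem expConv_nonneg (σ : ℝ → ℝ) {t : ℝ} (ht : 0 ≤ t) : 0 ≤ expConv σ t :=
  intervalIntegral.integral_nonneg ht fun s _ => by positivity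

theorem intervalIntegrable_sq {σ : ℝ → ℝ} (hσ : ContinuousOn σ (Ici 0)) {a b : ℝ}
    (ha : 0 ≤ a) (hb : 0 ≤ b) :
    IntervalIntegrable (fun s => (σ s) ^ 2) MeasureTheory.volume a b :=
  ContinuousOn.intervalIntegrable
    ((hσ.mono fun _ hx => (le_min ha hb).trans hx.1).pow 2)

theorem intervalIntegrable_exp_mul_sq {σ : ℝ → ℝ} (hσ : ContinuousOn σ (Ici 0)) (t : ℝ) {a b : ℝ}
    (ha : 0 ≤ a) (hb : 0 ≤ b) :
    IntervalIntegrable (fun s => Real.exp (-2 * (t - s)) * (σ s) ^ 2) MeasureTheory.volume a b :=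
  (intervalIntegrable_sq hσ ha hb).continuousOn_mul (by fun_prop)

theorem expConv_eq_add {σ : ℝ → ℝ} (hσ : ContinuousOn σ (Ici 0)) {a b : ℝ}
    (ha : 0 ≤ a) (hb : 0 ≤ b) :
    expConv σ b = Real.exp (-2 * (b - a)) * expConv σ a +
      ∫ s in a..b, Real.exp (-2 * (b - s)) * (σ s) ^ 2 := by
  unfold expConv
  rw [← intervalIntegral.integral_add_adjacent_intervals
    (intervalIntegrable_exp_mul_sq hσ b le_rfl ha) (intervalIntegrable_exp_mul_sq hσ b ha hb),
    ← intervalIntegral.integral_const_mul]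
  congr 2
  ext s
  rw [← mul_assoc, ← Real.exp_add]
  ring_nf

theorem exp_mul_expConv_le {σ : ℝ → ℝ} (hσ : ContinuousOn σ (Ici 0)) {a b : ℝ}
    (ha : 0 ≤ a) (hab : a ≤ b) :
    Real.exp (-2 * (b - a)) * expConv σ a ≤ expConv σ b := by
  rw [expConv_eq_add hσ ha (ha.trans hab)]
  exact le_add_of_nonneg_right
    (intervalIntegral.integral_nonneg hab fun s _ => by positivity)

theorem expConv_le_exp_two_mul {σ : ℝ → ℝ} (hσ : ContinuousOn σ (Ici 0)) {a b : ℝ}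
    (ha : 0 ≤ a) (hab : a ≤ b) (hba : b ≤ a + 1) :
    expConv σ a ≤ Real.exp 2 * expConv σ b := by
  have h := exp_mul_expConv_le hσ ha hab
  calc expConv σ a = Real.exp (2 * (b - a)) * (Real.exp (-2 * (b - a)) * expConv σ a) := by
        rw [← mul_assoc, ← Real.exp_add]; ring_nf; simp
    _ ≤ Real.exp (2 * (b - a)) * expConv σ b := by gcongr
    _ ≤ Real.exp 2 * expConv σ b := by
        have := expConv_nonneg σ (ha.trans hab)
        gcongr
        linarith

theorem theta_sq (σ : ℝ → ℝ) (n : ℕ) :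
    theta σ n ^ 2 = ∫ s in (n : ℝ)..((n : ℝ) + 1), (σ s) ^ 2 :=
  Real.sq_sqrt (intervalIntegral.integral_nonneg (by linarith) fun s _ => by positivity)

theorem exp_neg_two_mul_theta_sq_le {σ : ℝ → ℝ} (hσ : ContinuousOn σ (Ici 0)) (n : ℕ) :
    Real.exp (-2) * theta σ n ^ 2 ≤
      ∫ s in (n : ℝ)..((n : ℝ) + 1), Real.exp (-2 * ((n : ℝ) + 1 - s)) * (σ s) ^ 2 := by
  have hn : (0 : ℝ) ≤ n := n.cast_nonneg
  rw [theta_sq, ← intervalIntegral.integral_const_mul]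
  refine intervalIntegral.integral_mono_on (by linarith)
    ((intervalIntegrable_sq hσ hn (by linarith)).const_mul _)
    (intervalIntegrable_exp_mul_sq hσ _ hn (by linarith)) fun s hs => ?_
  have := hs.1
  gcongr
  linarith

theorem integral_exp_mul_sq_le_theta_sq {σ : ℝ → ℝ} (hσ : ContinuousOn σ (Ici 0)) (n : ℕ) :
    ∫ s in (n : ℝ)..((n : ℝ) + 1), Real.exp (-2 * ((n : ℝ) + 1 - s)) * (σ s) ^ 2 ≤
      theta σ n ^ 2 := by
  have hn : (0 : ℝ) ≤ n := n.cast_nonneg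
  rw [theta_sq]
  refine intervalIntegral.integral_mono_on (by linarith)
    (intervalIntegrable_exp_mul_sq hσ _ hn (by linarith))
    (intervalIntegrable_sq hσ hn (by linarith)) fun s hs => ?_
  have := hs.2
  refine mul_le_of_le_one_left (sq_nonneg _) (Real.exp_le_one_iff.2 ?_)
  linarith

theorem Theta2_succ (σ : ℝ → ℝ) (n : ℕ) :
    Theta2 σ (n + 1) = Real.exp (-2) * (Theta2 σ n + theta σ n ^ 2) := by
  unfold Theta2
  rw [Finset.sum_range_succ, mul_add, Finset.mul_sum]
  congr 1
  · refine Finset.sum_congr rfl fun j _ => ?_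
    rw [← mul_assoc, ← Real.exp_add]
    push_cast
    ring_nf
  · push_cast
    ring_nf

theorem expConv_natCast_succ {σ : ℝ → ℝ} (hσ : ContinuousOn σ (Ici 0)) (n : ℕ) :
    expConv σ (n + 1 : ℕ) = Real.exp (-2) * expConv σ n +
      ∫ s in (n : ℝ)..((n : ℝ) + 1), Real.exp (-2 * ((n : ℝ) + 1 - s)) * (σ s) ^ 2 := by
  have hn : (0 : ℝ) ≤ n := n.cast_nonneg
  rw [Nat.cast_add_one, expConv_eq_add hσ hn (by linarith), add_sub_cancel_left, mul_one]

theorem Theta2_le_expConv {σ : ℝ → ℝ} (hσ : ContinuousOn σ (Ici 0)) (n : ℕ) :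
    Theta2 σ n ≤ expConv σ n := by
  induction n with
  | zero => simp [Theta2, expConv]
  | succ n ih =>
    rw [Theta2_succ, expConv_natCast_succ hσ, mul_add]
    exact add_le_add (mul_le_mul_of_nonneg_left ih (Real.exp_pos _).le)
      (exp_neg_two_mul_theta_sq_le hσ n)

theorem expConv_le_exp_two_mul_Theta2 {σ : ℝ → ℝ} (hσ : ContinuousOn σ (Ici 0)) (n : ℕ) :
    expConv σ n ≤ Real.exp 2 * Theta2 σ n := by
  induction n with
  | zero => simp [Theta2, expConv]
  | succ n ih =>
    have h1 : Real.exp 2 * Real.exp (-2) = 1 := by rw [← Real.exp_add]; simp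
    have h2 : Real.exp (-2) * expConv σ n ≤ Real.exp (-2) * (Real.exp 2 * Theta2 σ n) :=
      mul_le_mul_of_nonneg_left ih (Real.exp_pos _).le
    rw [Theta2_succ, expConv_natCast_succ hσ, ← mul_assoc, h1, one_mul]
    rw [← mul_assoc, mul_comm (Real.exp (-2)) (Real.exp 2), h1, one_mul] at h2
    exact add_le_add h2 (integral_exp_mul_sq_le_theta_sq hσ n)

theorem theta_sq_le_exp_two_mul_expConv {σ : ℝ → ℝ} (hσ : ContinuousOn σ (Ici 0)) (n : ℕ) :
    theta σ n ^ 2 ≤ Real.exp 2 * expConv σ (n + 1 : ℕ) := by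
  have h1 : Real.exp 2 * Real.exp (-2) = 1 := by rw [← Real.exp_add]; simp
  have h2 : Real.exp (-2) * theta σ n ^ 2 ≤ expConv σ (n + 1 : ℕ) := by
    rw [expConv_natCast_succ hσ]
    have := expConv_nonneg σ (t := n) n.cast_nonneg
    exact (exp_neg_two_mul_theta_sq_le hσ n).trans (le_add_of_nonneg_left (by positivity))
  calc theta σ n ^ 2 = Real.exp 2 * (Real.exp (-2) * theta σ n ^ 2) := by
        rw [← mul_assoc, h1, one_mul]
    _ ≤ _ := mul_le_mul_of_nonneg_left h2 (Real.exp_pos _).le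

theorem Sig2_floor_le {σ : ℝ → ℝ} (hσ : ContinuousOn σ (Ici 0)) {t : ℝ} (ht : 1 ≤ t) :
    Sig2 σ (⌊t⌋₊ : ℕ) ≤ Real.exp 2 * Sig2 σ t := by
  have ht0 : 0 ≤ t := by linarith
  have h1 : (1 : ℝ) ≤ (⌊t⌋₊ : ℕ) := by exact_mod_cast (Nat.one_le_floor_iff t).2 ht
  have h2 : ((⌊t⌋₊ : ℕ) : ℝ) ≤ t := Nat.floor_le ht0
  rw [Sig2_eq, Sig2_eq, ← mul_assoc]
  exact mul_le_mul
    (expConv_le_exp_two_mul hσ (Nat.cast_nonneg _) h2 (Nat.lt_floor_add_one t).le)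
    (Real.log_le_log (by linarith) h2) (Real.log_nonneg h1)
    (mul_nonneg (Real.exp_pos _).le (expConv_nonneg σ ht0))

theorem theta_sq_mul_log_le {σ : ℝ → ℝ} (hσ : ContinuousOn σ (Ici 0)) (n : ℕ) :
    theta σ n ^ 2 * Real.log n ≤ Real.exp 2 * Sig2 σ (n + 1 : ℕ) := by
  have hlog : Real.log n ≤ Real.log (n + 1 : ℕ) := by
    rcases n.eq_zero_or_pos with rfl | hn
    · simp
    · exact Real.log_le_log (by exact_mod_cast hn) (by exact_mod_cast n.le_succ)
  rw [Sig2_eq, ← mul_assoc]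
  exact mul_le_mul (theta_sq_le_exp_two_mul_expConv hσ n) hlog (Real.log_natCast_nonneg n)
    (mul_nonneg (Real.exp_pos _).le (expConv_nonneg σ (Nat.cast_nonneg _)))

/-- The statements `liminf_{t→∞} Σ²(t) ∈ (0,∞)`, `liminf_{n→∞} Σ²(n) ∈ (0,∞)` and
`liminf_{n→∞} Θ²(n)·log n ∈ (0,∞)` are equivalent; each implies that
`liminf_{n→∞} θ(n)²·log n ∈ [0,∞)`, i.e. is finite. (Limits inferior taken in `EReal`.) -/
theorem stmt_7 (σ : ℝ → ℝ) (hσ : ContinuousOn σ (Set.Ici 0)) :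
    ((0 < Filter.liminf (fun t : ℝ => ((Sig2 σ t : ℝ) : EReal)) Filter.atTop ∧
        Filter.liminf (fun t : ℝ => ((Sig2 σ t : ℝ) : EReal)) Filter.atTop < ⊤) ↔
      (0 < Filter.liminf (fun n : ℕ => ((Sig2 σ n : ℝ) : EReal)) Filter.atTop ∧
        Filter.liminf (fun n : ℕ => ((Sig2 σ n : ℝ) : EReal)) Filter.atTop < ⊤)) ∧
    ((0 < Filter.liminf (fun n : ℕ => ((Sig2 σ n : ℝ) : EReal)) Filter.atTop ∧
        Filter.liminf (fun n : ℕ => ((Sig2 σ n : ℝ) : EReal)) Filter.atTop < ⊤) ↔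
      (0 < Filter.liminf (fun n : ℕ => ((Theta2 σ n * Real.log n : ℝ) : EReal))
            Filter.atTop ∧
        Filter.liminf (fun n : ℕ => ((Theta2 σ n * Real.log n : ℝ) : EReal))
            Filter.atTop < ⊤)) ∧
    ((0 < Filter.liminf (fun t : ℝ => ((Sig2 σ t : ℝ) : EReal)) Filter.atTop ∧
        Filter.liminf (fun t : ℝ => ((Sig2 σ t : ℝ) : EReal)) Filter.atTop < ⊤) →
      (0 ≤ Filter.liminf (fun n : ℕ => (((theta σ n) ^ 2 * Real.log n : ℝ) : EReal))
            Filter.atTop ∧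
        Filter.liminf (fun n : ℕ => (((theta σ n) ^ 2 * Real.log n : ℝ) : EReal))
            Filter.atTop < ⊤)) := by
  have he : (0 : ℝ) < Real.exp 2 := Real.exp_pos 2
  have hfloor : ∀ᶠ t : ℝ in atTop, Sig2 σ (⌊t⌋₊ : ℕ) ≤ Real.exp 2 * Sig2 σ t := by
    filter_upwards [eventually_ge_atTop 1] with t ht using Sig2_floor_le hσ ht
  have hcast : ∀ᶠ n : ℕ in atTop, Sig2 σ n ≤ 1 * Sig2 σ n := .of_forall fun n => by rw [one_mul]
  have hTheta : ∀ᶠ n : ℕ in atTop, Theta2 σ n * Real.log n ≤ 1 * Sig2 σ n :=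
    .of_forall fun n => by
      rw [one_mul, Sig2_eq]
      exact mul_le_mul_of_nonneg_right (Theta2_le_expConv hσ n) (Real.log_natCast_nonneg n)
  have hSig : ∀ᶠ n : ℕ in atTop, Sig2 σ n ≤ Real.exp 2 * (Theta2 σ n * Real.log n) :=
    .of_forall fun n => by
      rw [Sig2_eq, ← mul_assoc]
      exact mul_le_mul_of_nonneg_right (expConv_le_exp_two_mul_Theta2 hσ n)
        (Real.log_natCast_nonneg n)
  have htheta : ∀ᶠ n : ℕ in atTop,
      theta σ (n - 1) ^ 2 * Real.log (n - 1 : ℕ) ≤ Real.exp 2 * Sig2 σ n := by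
    filter_upwards [eventually_ge_atTop 1] with n hn
    simpa only [Nat.sub_add_cancel hn] using theta_sq_mul_log_le hσ (n - 1)
  have hfl := tendsto_nat_floor_atTop (α := ℝ)
  have hca := tendsto_natCast_atTop_atTop (R := ℝ)
  have real_lt_top_imp := liminf_coe_lt_top_of_le_mul (g := fun n : ℕ => Sig2 σ n) he hfl hfloor
  refine ⟨⟨fun h => ⟨?_, real_lt_top_imp h.2⟩, fun h => ⟨?_, ?_⟩⟩,
    ⟨fun h => ⟨?_, ?_⟩, fun h => ⟨?_, ?_⟩⟩, fun h => ⟨?_, ?_⟩⟩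
  · exact pos_liminf_coe_of_le_mul one_pos hca hcast h.1
  · exact pos_liminf_coe_of_le_mul (g := fun n : ℕ => Sig2 σ n) he hfl hfloor h.1
  · exact liminf_coe_lt_top_of_le_mul one_pos hca hcast h.2
  · exact pos_liminf_coe_of_le_mul (g := fun n : ℕ => Sig2 σ n) he tendsto_id hSig h.1
  · exact liminf_coe_lt_top_of_le_mul (g := fun n : ℕ => Theta2 σ n * Real.log n)
      one_pos tendsto_id hTheta h.2
  · exact pos_liminf_coe_of_le_mul (g := fun n : ℕ => Theta2 σ n * Real.log n)
      one_pos tendsto_id hTheta h.1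
  · exact liminf_coe_lt_top_of_le_mul (g := fun n : ℕ => Sig2 σ n) he tendsto_id hSig h.2
  · refine le_liminf_of_le (by isBoundedDefault) (.of_forall fun n => ?_)
    exact_mod_cast mul_nonneg (sq_nonneg (theta σ n)) (Real.log_natCast_nonneg n)
  · exact liminf_coe_lt_top_of_le_mul (g := fun n : ℕ => theta σ n ^ 2 * Real.log n)
      he (tendsto_sub_atTop_nat 1) htheta (real_lt_top_imp h.2)
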